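/- The Moore neighborhood of radius one, N⁺ = ({−1,0,1}×{−1,0,1}) ∖ {(0,0)}, cannot perform crossing: there is no n and no vectors n̄,ē,s̄,w̄ ∈ E_n for which a crossing configuration exists. -/

import Mathlib

open Finset

/-- Vertices of the two-dimensional grid. -/
abbrev Vertex := ℤ × ℤ

/-- A configuration assigns a number of grains to each vertex. -/
abbrev Config := Vertex → ℕ

/-- Parallel abelian sandpile dynamics with uniform neighborhood `N`:
`F(c)(v) = c(v) - p·𝟙[c(v) ≥ p] + |{u | v - u ∈ N ∧ c(u) ≥ p}|` with `p = |N|`.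
(The vertices `u` with `v - u ∈ N` are exactly the `v - d` for `d ∈ N`.) -/
def sandF (N : Finset Vertex) (c : Config) : Config := fun v =>
  (c v - if N.card ≤ c v then N.card else 0)
    + (N.filter (fun d => N.card ≤ c (v - d))).card

/-- A configuration is stable when every vertex has fewer than `p = |N|` grains. -/
def Stable (N : Finset Vertex) (c : Config) : Prop := ∀ v, c v < N.card

/-- The set of unstable vertices of a configuration. -/
def Act (N : Finset Vertex) (c : Config) : Set Vertex := {v | N.card ≤ c v}

/-- A configuration is finite when only finitely many vertices carry grains. -/
def FiniteConf (c : Config) : Prop := {v | 0 < c v}.Finite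

/-- A configuration has size `n × m` (positioned at the origin). -/
def HasSize (n m : ℕ) (c : Config) : Prop :=
  ∀ v : Vertex, ¬(0 ≤ v.1 ∧ v.1 < (n : ℤ) ∧ 0 ≤ v.2 ∧ v.2 < (m : ℤ)) → c v = 0

/-- A vector of `E_n`: entries in `{0,1}`, supported on indices `< n`,
with exactly one entry equal to `1`. -/
def IsUnitVec (n : ℕ) (e : ℕ → ℕ) : Prop :=
  (∀ i, e i ≤ 1) ∧ (∀ i, n ≤ i → e i = 0) ∧ (∃! i, e i = 1)

/-- Positioning of a vector on the north border: `N(ē)(x,y) = ē(x)` if `y = 0`. -/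
def confN (n : ℕ) (e : ℕ → ℕ) : Config := fun v =>
  if v.2 = 0 ∧ 0 ≤ v.1 ∧ v.1 < (n : ℤ) then e v.1.toNat else 0

/-- Positioning of a vector on the south border: `S(ē)(x,y) = ē(x)` if `y = n-1`. -/
def confS (n : ℕ) (e : ℕ → ℕ) : Config := fun v =>
  if v.2 = (n : ℤ) - 1 ∧ 0 ≤ v.1 ∧ v.1 < (n : ℤ) then e v.1.toNat else 0

/-- Positioning of a vector on the west border: `W(ē)(x,y) = ē(y)` if `x = 0`. -/
def confW (n : ℕ) (e : ℕ → ℕ) : Config := fun v =>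
  if v.1 = 0 ∧ 0 ≤ v.2 ∧ v.2 < (n : ℤ) then e v.2.toNat else 0

/-- Positioning of a vector on the east border: `E(ē)(x,y) = ē(y)` if `x = n-1`. -/
def confE (n : ℕ) (e : ℕ → ℕ) : Config := fun v =>
  if v.1 = (n : ℤ) - 1 ∧ 0 ≤ v.2 ∧ v.2 < (n : ℤ) then e v.2.toNat else 0

/-- `c` is a transporter from west to east with vectors `w, e`. -/
def TransporterWE (N : Finset Vertex) (n : ℕ) (c : Config) (w e : ℕ → ℕ) : Prop :=
  ∃ t : ℕ, Act N ((sandF N)^[t] (c + confW n w)) = {v : Vertex | confE n e v = 1}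

/-- `c` is a transporter from north to south with vectors `nv, s`. -/
def TransporterNS (N : Finset Vertex) (n : ℕ) (c : Config) (nv s : ℕ → ℕ) : Prop :=
  ∃ t : ℕ, Act N ((sandF N)^[t] (c + confN n nv)) = {v : Vertex | confS n s v = 1}

/-- `c` has west vector `w` isolated to the south. -/
def IsolatedWS (N : Finset Vertex) (n : ℕ) (c : Config) (w : ℕ → ℕ) : Prop :=
  ∀ t : ℕ, ∀ v ∈ Act N ((sandF N)^[t] (c + confW n w)), v.2 ≠ (n : ℤ) - 1

/-- `c` has north vector `nv` isolated to the east. -/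
def IsolatedNE (N : Finset Vertex) (n : ℕ) (c : Config) (nv : ℕ → ℕ) : Prop :=
  ∀ t : ℕ, ∀ v ∈ Act N ((sandF N)^[t] (c + confN n nv)), v.1 ≠ (n : ℤ) - 1

/-- `c` is a crossing configuration of size `n × n` with vectors `nv, e, s, w ∈ E_n`. -/
def CrossingConfig (N : Finset Vertex) (n : ℕ) (c : Config)
    (nv e s w : ℕ → ℕ) : Prop :=
  IsUnitVec n nv ∧ IsUnitVec n e ∧ IsUnitVec n s ∧ IsUnitVec n w ∧
  Stable N c ∧ HasSize n n c ∧
  TransporterWE N n c w e ∧ IsolatedWS N n c w ∧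
  TransporterNS N n c nv s ∧ IsolatedNE N n c nv

/-- A neighborhood can perform crossing when some crossing configuration exists. -/
def CanCross (N : Finset Vertex) : Prop :=
  ∃ (n : ℕ) (c : Config) (nv e s w : ℕ → ℕ), CrossingConfig N n c nv e s w

/-- The neighborhood of a shape `s ⊆ ℝ²` with scaling ratio `r`. -/
def shapeNbhd (s : Set (ℝ × ℝ)) (r : ℝ) : Set Vertex :=
  {v : Vertex | (((v.1 : ℝ) / r, (v.2 : ℝ) / r) : ℝ × ℝ) ∈ s} \ {((0 : ℤ), (0 : ℤ))}

/-- A set `s ⊆ ℝ²` is non-flat when every point of `s` is a vertex of a triangle of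
strictly positive area (three non-collinear points) entirely contained in `s`. -/
def NonFlat (s : Set (ℝ × ℝ)) : Prop :=
  ∀ x ∈ s, ∃ b c : ℝ × ℝ, ¬ Collinear ℝ ({x, b, c} : Set (ℝ × ℝ)) ∧
    convexHull ℝ ({x, b, c} : Set (ℝ × ℝ)) ⊆ s

/-- The Moore neighborhood of radius one. -/
abbrev moore : Finset Vertex :=
  (({-1, 0, 1} : Finset ℤ) ×ˢ ({-1, 0, 1} : Finset ℤ)) \ ({((0 : ℤ), (0 : ℤ))} : Finset Vertex)

lemma card_moore : moore.card = 8 := by decide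

lemma mem_moore {d : Vertex} :
    d ∈ moore ↔ (-1 ≤ d.1 ∧ d.1 ≤ 1 ∧ -1 ≤ d.2 ∧ d.2 ≤ 1) ∧ ¬(d.1 = 0 ∧ d.2 = 0) := by
  obtain ⟨x, y⟩ := d
  simp only [moore, mem_sdiff, mem_product, mem_insert, mem_singleton, Prod.mk.injEq]
  omega

open Classical in
/-- The number of Moore neighbors of `v` that belong to `D`. -/
noncomputable def neighborCount (D : Set Vertex) (v : Vertex) : ℕ :=
  (moore.filter (fun d => v - d ∈ D)).card

lemma neighborCount_le (D : Set Vertex) (v : Vertex) : neighborCount D v ≤ 8 := by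
  classical
  exact (card_filter_le _ _).trans_eq card_moore

lemma neighborCount_mono {D E : Set Vertex} (h : D ⊆ E) (v : Vertex) :
    neighborCount D v ≤ neighborCount E v := by
  classical
  exact card_le_card (monotone_filter_right _ fun _ _ hd => h hd)

lemma neighborCount_lt {D : Set Vertex} {v d : Vertex} (hd : d ∈ moore) (hv : v - d ∉ D) :
    neighborCount D v < 8 := by
  classical
  rw [← card_moore]
  exact card_lt_card (filter_ssubset.2 ⟨d, hd, hv⟩)

lemma neighborCount_pos {D : Set Vertex} {v d : Vertex} (hd : d ∈ moore) (hv : v - d ∈ D) :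
    0 < neighborCount D v :=
  card_pos.2 ⟨d, by simpa only [mem_filter] using ⟨hd, hv⟩⟩

lemma exists_mem_notMem_of_neighborCount_lt {D E : Set Vertex} {v : Vertex}
    (h : neighborCount E v < neighborCount D v) : ∃ d ∈ moore, v - d ∈ D ∧ v - d ∉ E := by
  by_contra! hc
  refine absurd h (not_lt.2 (card_le_card fun d hd => ?_))
  simp only [mem_filter] at hd ⊢
  exact ⟨hd.1, hc d hd.1 hd.2⟩

lemma neighborCount_union {D E : Set Vertex} (h : Disjoint D E) (v : Vertex) :
    neighborCount (D ∪ E) v = neighborCount D v + neighborCount E v := by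
  classical
  unfold neighborCount
  rw [← card_union_of_disjoint, ← filter_or]
  · simp only [Set.mem_union]
  · exact disjoint_filter.2 fun d _ hD hE => Set.disjoint_left.1 h hD hE

open Classical in
lemma neighborCount_eq (D : Set Vertex) (x y : ℤ) :
    neighborCount D (x, y) =
      (if (x - 1, y - 1) ∈ D then 1 else 0) + (if (x - 1, y) ∈ D then 1 else 0) +
      (if (x - 1, y + 1) ∈ D then 1 else 0) + (if (x, y - 1) ∈ D then 1 else 0) +
      (if (x, y + 1) ∈ D then 1 else 0) + (if (x + 1, y - 1) ∈ D then 1 else 0) +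
      (if (x + 1, y) ∈ D then 1 else 0) + (if (x + 1, y + 1) ∈ D then 1 else 0) := by
  have h : moore = {(1, 1), (1, 0), (1, -1), (0, 1), (0, -1), (-1, 1), (-1, 0), (-1, -1)} := by
    decide
  rw [neighborCount, card_filter, h]
  simp [-sum_boole]
  ring

/-- No unit square can have one diagonal in `A \ B` and the other in `B \ A` when vertices of
each side see more neighbors of their own side than of the other. -/
lemma not_diagonal_crossing {A B : Set Vertex}
    (hA : ∀ a ∈ A, a ∉ B → ∀ d ∈ moore, a - d ∈ B → neighborCount B a < neighborCount A a)
    (hB : ∀ b ∈ B, b ∉ A → ∀ d ∈ moore, b - d ∈ A → neighborCount A b < neighborCount B b)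
    {x y : ℤ} (h1 : (x, y) ∈ A) (h1' : (x, y) ∉ B)
    (h2 : (x + 1, y + 1) ∈ A) (h2' : (x + 1, y + 1) ∉ B)
    (h3 : (x + 1, y) ∈ B) (h3' : (x + 1, y) ∉ A)
    (h4 : (x, y + 1) ∈ B) (h4' : (x, y + 1) ∉ A) : False := by
  classical
  have i1 := hA _ h1 h1' (-1, 0) (by decide) (by simpa using h3)
  have i2 := hA _ h2 h2' (1, 0) (by decide) (by simpa using h4)
  have i3 := hB _ h3 h3' (1, 0) (by decide) (by simpa using h1)
  have i4 := hB _ h4 h4' (-1, 0) (by decide) (by simpa using h2)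
  rw [neighborCount_eq, neighborCount_eq] at i1 i2 i3 i4
  simp only [add_sub_cancel_right, h1, h1', h2, h2', h3, h3', h4, h4', if_true, if_false]
    at i1 i2 i3 i4
  have le_one : ∀ (D : Set Vertex) (v : Vertex), (if v ∈ D then 1 else 0) ≤ 1 := by
    intro D v; split_ifs <;> simp
  have j1 := le_one A (x - 1, y - 1)
  have j2 := le_one A (x + 1 + 1, y + 1 + 1)
  have j3 := le_one B (x + 1 + 1, y - 1)
  have j4 := le_one B (x - 1, y + 1 + 1)
  omega

/-- The square of side `n` positioned at the origin. -/
def gridSquare (n : ℕ) : Set Vertex := {v | 0 ≤ v.1 ∧ v.1 < (n : ℤ) ∧ 0 ≤ v.2 ∧ v.2 < (n : ℤ)}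

/-- The vertices that are unstable at some time before `t`. -/
def firedBefore (c : Config) (t : ℕ) : Set Vertex :=
  {v | ∃ s < t, v ∈ Act moore ((sandF moore)^[s] c)}

/-- The vertices that are unstable at some time. -/
def fired (c : Config) : Set Vertex := {v | ∃ s, v ∈ Act moore ((sandF moore)^[s] c)}

lemma firedBefore_subset_fired (c : Config) (t : ℕ) : firedBefore c t ⊆ fired c :=
  fun _ ⟨s, _, hs⟩ => ⟨s, hs⟩

lemma firedBefore_mono (c : Config) : Monotone (firedBefore c) :=
  fun _ _ h _ ⟨s, hs, hv⟩ => ⟨s, hs.trans_le h, hv⟩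

lemma firedBefore_succ (c : Config) (t : ℕ) :
    firedBefore c (t + 1) = firedBefore c t ∪ Act moore ((sandF moore)^[t] c) := by
  ext v
  simp only [firedBefore, Set.mem_ofPred_eq, Set.mem_union, Nat.lt_succ_iff_lt_or_eq]
  constructor
  · rintro ⟨s, hs | rfl, hv⟩
    exacts [.inl ⟨s, hs, hv⟩, .inr hv]
  · rintro (⟨s, hs, hv⟩ | hv)
    exacts [⟨s, .inl hs, hv⟩, ⟨t, .inr rfl, hv⟩]

lemma exists_neighborCount_firedBefore_eq (c : Config) (v : Vertex) :
    ∃ t, neighborCount (fired c) v = neighborCount (firedBefore c t) v := by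
  classical
  have h : ∀ d, ∃ t, v - d ∈ fired c → v - d ∈ firedBefore c t := by
    intro d
    by_cases hd : v - d ∈ fired c
    · obtain ⟨s, hs⟩ := hd
      exact ⟨s + 1, fun _ => ⟨s, s.lt_succ_self, hs⟩⟩
    · exact ⟨0, fun h => absurd h hd⟩
  choose T hT using h
  refine ⟨moore.sup T, le_antisymm (card_le_card fun d hd => ?_)
    (neighborCount_mono (firedBefore_subset_fired c _) v)⟩
  simp only [mem_filter] at hd ⊢
  exact ⟨hd.1, firedBefore_mono c (le_sup hd.1) (hT d hd.2)⟩

lemma sandF_moore_apply (c : Config) (v : Vertex) :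
    sandF moore c v = (c v - if 8 ≤ c v then 8 else 0) + neighborCount (Act moore c) v := by
  simp only [sandF, neighborCount, Act, card_moore, Set.mem_ofPred_eq]

lemma mem_Act_moore {c : Config} {v : Vertex} : v ∈ Act moore c ↔ 8 ≤ c v := by
  simp only [Act, card_moore, Set.mem_ofPred_eq]

/-- A stable configuration contained in the square of side `n`, with a vertex on the border
of that square. -/
structure BorderSeed (n : ℕ) (c : Config) (seed : Vertex) : Prop where
  stable : ∀ v, c v < 8
  support : ∀ v ∉ gridSquare n, c v = 0
  mem_gridSquare : seed ∈ gridSquare n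
  border : ∃ d ∈ moore, seed - d ∉ gridSquare n

/-- The configuration `c` with one grain added on `seed`. -/
def withGrain (c : Config) (seed : Vertex) : Config := fun v => c v + if v = seed then 1 else 0

lemma withGrain_of_ne (c : Config) {seed v : Vertex} (hv : v ≠ seed) :
    withGrain c seed v = c v := by
  simp [withGrain, hv]

lemma exists_neighbor_notMem_gridSquare {n : ℕ} {v : Vertex} (hv : v ∉ gridSquare n) :
    ∃ d ∈ moore, v - d ∉ gridSquare n := by
  obtain ⟨x, y⟩ := v
  simp only [gridSquare, Set.mem_ofPred_eq, Prod.fst_sub, Prod.snd_sub] at hv ⊢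
  by_cases h1 : x < 0
  · exact ⟨(1, 0), by decide, by dsimp; omega⟩
  by_cases h2 : (n : ℤ) ≤ x
  · exact ⟨(-1, 0), by decide, by dsimp; omega⟩
  by_cases h3 : y < 0
  · exact ⟨(0, 1), by decide, by dsimp; omega⟩
  · exact ⟨(0, -1), by decide, by dsimp; omega⟩

namespace BorderSeed

variable {n : ℕ} {c : Config} {seed : Vertex}

lemma disjoint_and_subset_of_balance (h : BorderSeed n c seed) {D : Set Vertex}
    (hD : D ⊆ gridSquare n)
    {c' : Config} (h1 : ∀ v ∈ D, c' v + 8 = withGrain c seed v + neighborCount D v)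
    (h2 : ∀ v ∉ D, c' v = withGrain c seed v + neighborCount D v) :
    Disjoint D (Act moore c') ∧ Act moore c' ⊆ gridSquare n := by
  obtain ⟨d, hd, hseed⟩ := h.border
  have hs := neighborCount_lt hd (fun hmem => hseed (hD hmem))
  constructor
  · refine Set.disjoint_left.2 fun v hv hact => ?_
    rw [mem_Act_moore] at hact
    have e := h1 v hv
    have := h.stable v
    have := neighborCount_le D v
    by_cases hvs : v = seed
    · subst hvs
      simp only [withGrain, if_true] at e
      omega
    · rw [withGrain_of_ne c hvs] at e
      omega
  · intro v hact
    by_contra hv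
    rw [mem_Act_moore] at hact
    obtain ⟨d, hd, hvd⟩ := exists_neighbor_notMem_gridSquare hv
    have hlt := neighborCount_lt hd (fun hmem => hvd (hD hmem))
    have e := h2 v (fun hmem => hv (hD hmem))
    have := h.support v hv
    rw [withGrain_of_ne c (show v ≠ seed from fun hvs => hv (hvs ▸ h.mem_gridSquare))] at e
    omega

lemma odometer (h : BorderSeed n c seed) (t : ℕ) :
    firedBefore (withGrain c seed) t ⊆ gridSquare n ∧
    (∀ v ∈ firedBefore (withGrain c seed) t, (sandF moore)^[t] (withGrain c seed) v + 8 =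
      withGrain c seed v + neighborCount (firedBefore (withGrain c seed) t) v) ∧
    (∀ v ∉ firedBefore (withGrain c seed) t, (sandF moore)^[t] (withGrain c seed) v =
      withGrain c seed v + neighborCount (firedBefore (withGrain c seed) t) v) := by
  induction t with
  | zero => simp [firedBefore, neighborCount]
  | succ t ih =>
    obtain ⟨hbox, h1, h2⟩ := ih
    obtain ⟨hdisj, hact⟩ := h.disjoint_and_subset_of_balance hbox h1 h2
    rw [firedBefore_succ]
    simp only [Function.iterate_succ_apply', sandF_moore_apply, neighborCount_union hdisj]
    refine ⟨Set.union_subset hbox hact, ?_, ?_⟩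
    · rintro v (hv | hv)
      · have := Set.disjoint_left.1 hdisj hv
        rw [mem_Act_moore] at this
        rw [if_neg this]
        have := h1 v hv
        omega
      · have := h2 v (Set.disjoint_right.1 hdisj hv)
        rw [mem_Act_moore] at hv
        rw [if_pos hv]
        omega
    · intro v hv
      rw [Set.mem_union, not_or, mem_Act_moore] at hv
      rw [if_neg hv.2]
      have := h2 v hv.1
      omega

lemma le_of_mem_Act (h : BorderSeed n c seed) {t : ℕ} {v : Vertex}
    (hv : v ∈ Act moore ((sandF moore)^[t] (withGrain c seed))) :
    8 ≤ withGrain c seed v + neighborCount (firedBefore (withGrain c seed) t) v := by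
  obtain ⟨hbox, h1, h2⟩ := h.odometer t
  have hdisj := (h.disjoint_and_subset_of_balance hbox h1 h2).1
  rw [← h2 v (Set.disjoint_right.1 hdisj hv)]
  exact mem_Act_moore.1 hv

lemma fired_subset_gridSquare (h : BorderSeed n c seed) : fired (withGrain c seed) ⊆ gridSquare n :=
  fun _ ⟨s, hs⟩ => (h.odometer (s + 1)).1 ⟨s, s.lt_succ_self, hs⟩

lemma le_of_mem_fired (h : BorderSeed n c seed) {v : Vertex}
    (hv : v ∈ fired (withGrain c seed)) :
    8 ≤ withGrain c seed v + neighborCount (fired (withGrain c seed)) v := by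
  obtain ⟨s, hs⟩ := hv
  have := neighborCount_mono (firedBefore_subset_fired (withGrain c seed) s) v
  have := h.le_of_mem_Act hs
  omega

lemma lt_of_notMem_fired (h : BorderSeed n c seed) {v : Vertex}
    (hv : v ∉ fired (withGrain c seed)) :
    c v + neighborCount (fired (withGrain c seed)) v < 8 := by
  obtain ⟨t, ht⟩ := exists_neighborCount_firedBefore_eq (withGrain c seed) v
  have e := (h.odometer t).2.2 v (fun hmem => hv (firedBefore_subset_fired _ t hmem))
  have hlt : ¬ 8 ≤ (sandF moore)^[t] (withGrain c seed) v :=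
    fun hle => hv ⟨t, mem_Act_moore.2 hle⟩
  have hle : c v ≤ withGrain c seed v := Nat.le_add_right _ _
  omega

lemma seed_critical_of_mem_Act (h : BorderSeed n c seed) (t : ℕ) :
    ∀ v ∈ Act moore ((sandF moore)^[t] (withGrain c seed)), c seed = 7 := by
  induction t using Nat.strong_induction_on with
  | _ t ih =>
    intro v hv
    have hle := h.le_of_mem_Act hv
    have := h.stable v
    by_cases hpos : neighborCount ∅ v < neighborCount (firedBefore (withGrain c seed) t) v
    · obtain ⟨d, -, ⟨s, hs, hmem⟩, -⟩ := exists_mem_notMem_of_neighborCount_lt hpos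
      exact ih s hs _ hmem
    · have : neighborCount ∅ v = 0 := by simp [neighborCount]
      by_cases hvs : v = seed
      · subst hvs
        simp only [withGrain, if_true] at hle
        omega
      · rw [withGrain_of_ne c hvs] at hle
        omega

variable {seed' : Vertex}

/-- A vertex fired only from `seed` has more neighbors fired from `seed` than from `seed'`, as soon
as it has one of the latter. -/
lemma neighborCount_lt_neighborCount (h : BorderSeed n c seed) (h' : BorderSeed n c seed') :
    ∀ a ∈ fired (withGrain c seed), a ∉ fired (withGrain c seed') →
      ∀ d ∈ moore, a - d ∈ fired (withGrain c seed') →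
      neighborCount (fired (withGrain c seed')) a < neighborCount (fired (withGrain c seed)) a := by
  intro a ha ha' d hd hb
  have hlt := h'.lt_of_notMem_fired ha'
  have hle := h.le_of_mem_fired ha
  by_cases has : a = seed
  · obtain ⟨s, hs⟩ := ha
    have := h.seed_critical_of_mem_Act s a hs
    have := neighborCount_pos hd hb
    subst has
    omega
  · rw [withGrain_of_ne c has] at hle
    omega

/-- The vertices fired from `seed` but not from `seed'` are all connected to `seed` through such
vertices. -/
lemma fired_diff_induction (h : BorderSeed n c seed) (h' : BorderSeed n c seed')
    {P : Vertex → Prop} (base : P seed)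
    (step : ∀ u v, u ∈ fired (withGrain c seed) → u ∉ fired (withGrain c seed') →
      v ∈ fired (withGrain c seed) → v ∉ fired (withGrain c seed') → v - u ∈ moore → P u → P v)
    {v : Vertex} (hv : v ∈ fired (withGrain c seed)) (hv' : v ∉ fired (withGrain c seed')) :
    P v := by
  obtain ⟨t, ht⟩ := hv
  induction t using Nat.strong_induction_on generalizing v with
  | _ t ih =>
    by_cases hvs : v = seed
    · exact hvs ▸ base
    have hle := h.le_of_mem_Act ht
    have hlt := h'.lt_of_notMem_fired hv'
    rw [withGrain_of_ne c hvs] at hle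
    obtain ⟨d, hd, ⟨s, hs, hmem⟩, hnot⟩ := exists_mem_notMem_of_neighborCount_lt
      (show neighborCount (fired (withGrain c seed')) v <
        neighborCount (firedBefore (withGrain c seed) t) v by omega)
    exact step (v - d) v ⟨s, hmem⟩ hnot ⟨t, ht⟩ hv' (by rwa [sub_sub_cancel]) (ih s hs hnot hmem)

end BorderSeed

/-- The signed number of times that a step from `u` to `v` goes from the column `x` to the next one
with its endpoint in the column `x` above the row `y`. -/
def flux (u v : Vertex) (x y : ℤ) : ℤ :=
  (if u.1 = x ∧ v.1 = x + 1 ∧ u.2 < y then 1 else 0) -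
    if u.1 = x + 1 ∧ v.1 = x ∧ v.2 < y then 1 else 0

lemma flux_vertical {u v : Vertex} {x y y' : ℤ} (hy : y' = y + 1)
    (hu : u ≠ (x, y)) (hv : v ≠ (x, y)) : flux u v x y' = flux u v x y := by
  obtain ⟨u1, u2⟩ := u
  obtain ⟨v1, v2⟩ := v
  simp only [ne_eq, Prod.mk.injEq] at hu hv
  simp only [flux]
  split_ifs <;> omega

lemma flux_horizontal {u v : Vertex} {x y y' : ℤ} (huv : v - u ∈ moore)
    (hy : y - 1 ≤ y' ∧ y' ≤ y + 1) (hu : u ≠ (x, y)) (hu' : u ≠ (x + 1, y'))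
    (hv : v ≠ (x, y)) (hv' : v ≠ (x + 1, y'))
    (hcross : y' ≠ y → ¬(u = (x, y') ∧ v = (x + 1, y)) ∧ ¬(u = (x + 1, y) ∧ v = (x, y'))) :
    flux u v (x + 1) y' - flux u v x y =
      (if u.1 = x + 1 ∧ u.2 < y' then 1 else 0) - if v.1 = x + 1 ∧ v.2 < y' then 1 else 0 := by
  obtain ⟨u1, u2⟩ := u
  obtain ⟨v1, v2⟩ := v
  rw [mem_moore] at huv
  simp only [ne_eq, Prod.mk.injEq, Prod.fst_sub, Prod.snd_sub] at hu hu' hv hv' huv hcross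
  simp only [flux]
  split_ifs <;> omega

lemma flux_bottom {u v : Vertex} {y : ℤ} (huv : v - u ∈ moore) (hu : u.2 < y) (hv : v.2 < y)
    (x : ℤ) : flux u v x y = (if x < v.1 then 1 else 0) - if x < u.1 then 1 else 0 := by
  obtain ⟨u1, u2⟩ := u
  obtain ⟨v1, v2⟩ := v
  rw [mem_moore] at huv
  simp only [Prod.fst_sub, Prod.snd_sub] at huv
  simp only [flux]
  split_ifs <;> omega

/-- The total flux of a path from `w` to `v` avoiding the vertices fired from `m`, as a function of
the position, is constant along steps between vertices fired only from `m`, up to the contribution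
of the endpoints. -/
lemma exists_flux_potential {n : ℕ} {c : Config} {w m : Vertex} (hw : BorderSeed n c w)
    (hm : BorderSeed n c m) (hS : ∀ v ∈ fired (withGrain c w), v.2 ≠ (n : ℤ) - 1)
    {v : Vertex} (hv : v ∈ fired (withGrain c w)) (hv' : v ∉ fired (withGrain c m)) :
    ∃ H : ℤ → ℤ → ℤ, (∀ x, H x 0 = 0) ∧
      (∀ x, H x ((n : ℤ) - 1) = (if x < v.1 then 1 else 0) - if x < w.1 then 1 else 0) ∧
      (∀ x y, (x, y) ∉ fired (withGrain c w) → H x (y + 1) = H x y) ∧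
      (∀ x y y', (x, y) ∈ fired (withGrain c m) → (x, y) ∉ fired (withGrain c w) →
        (x + 1, y') ∈ fired (withGrain c m) → (x + 1, y') ∉ fired (withGrain c w) →
        y - 1 ≤ y' ∧ y' ≤ y + 1 → H (x + 1) y' - H x y =
          (if w.1 = x + 1 ∧ w.2 < y' then 1 else 0) -
            if v.1 = x + 1 ∧ v.2 < y' then 1 else 0) := by
  refine hw.fired_diff_induction hm (P := fun v => ∃ H : ℤ → ℤ → ℤ, (∀ x, H x 0 = 0) ∧
      (∀ x, H x ((n : ℤ) - 1) = (if x < v.1 then 1 else 0) - if x < w.1 then 1 else 0) ∧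
      (∀ x y, (x, y) ∉ fired (withGrain c w) → H x (y + 1) = H x y) ∧
      (∀ x y y', (x, y) ∈ fired (withGrain c m) → (x, y) ∉ fired (withGrain c w) →
        (x + 1, y') ∈ fired (withGrain c m) → (x + 1, y') ∉ fired (withGrain c w) →
        y - 1 ≤ y' ∧ y' ≤ y + 1 → H (x + 1) y' - H x y =
          (if w.1 = x + 1 ∧ w.2 < y' then 1 else 0) -
            if v.1 = x + 1 ∧ v.2 < y' then 1 else 0)) ?_ ?_ hv hv'
  · exact ⟨fun _ _ => 0, by simp⟩
  rintro u v hu hu' hv hv' huv ⟨H, top, bottom, vert, horiz⟩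
  have hne : ∀ {a b : Vertex}, a ∈ fired (withGrain c w) → b ∉ fired (withGrain c w) → a ≠ b :=
    fun ha hb hab => hb (hab ▸ ha)
  have hA := hw.neighborCount_lt_neighborCount hm
  have hB := hm.neighborCount_lt_neighborCount hw
  obtain ⟨-, -, hu0, hun⟩ := hw.fired_subset_gridSquare hu
  obtain ⟨-, -, hv0, hvn⟩ := hw.fired_subset_gridSquare hv
  have huS := hS u hu
  have hvS := hS v hv
  refine ⟨fun x y => H x y + flux u v x y, fun x => ?_, fun x => ?_, fun x y hb => ?_,
    fun x y y' h1 h1' h2 h2' hy => ?_⟩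
  · simp only [top, flux]
    split_ifs <;> omega
  · simp only [bottom, flux_bottom huv (show u.2 < (n : ℤ) - 1 by omega)
      (show v.2 < (n : ℤ) - 1 by omega)]
    ring
  · simp only [vert x y hb, flux_vertical rfl (hne hu hb) (hne hv hb)]
  · have key := flux_horizontal huv hy (hne hu h1') (hne hu h2') (hne hv h1') (hne hv h2') ?_
    · have := horiz x y y' h1 h1' h2 h2' hy
      simp only
      linarith
    intro hyy
    have hcases : y' = y + 1 ∨ y = y' + 1 := by omega
    constructor <;> rintro ⟨rfl, rfl⟩ <;> rcases hcases with rfl | rfl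
    · exact not_diagonal_crossing hB hA h1 h1' h2 h2' hv hv' hu hu'
    · exact not_diagonal_crossing hA hB hu hu' hv hv' h2 h2' h1 h1'
    · exact not_diagonal_crossing hB hA h1 h1' h2 h2' hu hu' hv hv'
    · exact not_diagonal_crossing hA hB hv hv' hu hu' h2 h2' h1 h1'

/-- Two seeds, one in the first column and one in the first row, cannot send their grains
respectively to the last column and to the last row while avoiding the other's target side. -/
lemma not_crossing {n : ℕ} {c : Config} {w m e s : Vertex} (hw : BorderSeed n c w)
    (hm : BorderSeed n c m) (hw0 : w.1 = 0) (hm0 : m.2 = 0)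
    (he : e.1 = (n : ℤ) - 1) (hs : s.2 = (n : ℤ) - 1)
    (heA : e ∈ fired (withGrain c w)) (hsB : s ∈ fired (withGrain c m))
    (hS : ∀ v ∈ fired (withGrain c w), v.2 ≠ (n : ℤ) - 1)
    (hE : ∀ v ∈ fired (withGrain c m), v.1 ≠ (n : ℤ) - 1) : False := by
  have heB : e ∉ fired (withGrain c m) := fun h => hE e h he
  have hsA : s ∉ fired (withGrain c w) := fun h => hS s h hs
  obtain ⟨H, top, bottom, vert, horiz⟩ := exists_flux_potential hw hm hS heA heB
  have hright : ∀ x y y', (x, y) ∈ fired (withGrain c m) → (x, y) ∉ fired (withGrain c w) →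
      (x + 1, y') ∈ fired (withGrain c m) → (x + 1, y') ∉ fired (withGrain c w) →
      y - 1 ≤ y' ∧ y' ≤ y + 1 → H (x + 1) y' = H x y := by
    intro x y y' h1 h1' h2 h2' hy
    have key := horiz x y y' h1 h1' h2 h2' hy
    have hx : 0 ≤ x := (hm.fired_subset_gridSquare h1).1
    have hx' : x + 1 ≠ (n : ℤ) - 1 := hE _ h2
    rw [if_neg (by omega), if_neg (by omega)] at key
    omega
  have hzero : H s.1 s.2 = 0 := by
    refine hm.fired_diff_induction hw (P := fun b => H b.1 b.2 = 0) (by rw [hm0, top]) ?_ hsB hsA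
    rintro ⟨x, y⟩ ⟨x', y'⟩ h1 h1' h2 h2' hd h0
    rw [mem_moore] at hd
    simp only [Prod.fst_sub, Prod.snd_sub] at hd h0 ⊢
    obtain hx | rfl | rfl : x' = x ∨ x' = x + 1 ∨ x = x' + 1 := by omega
    · subst hx
      obtain rfl | rfl : y' = y + 1 ∨ y = y' + 1 := by omega
      · rw [vert _ _ h1', h0]
      · rw [← vert _ _ h2', h0]
    · rw [hright x y y' h1 h1' h2 h2' (by omega), h0]
    · rw [← hright x' y' y h2 h2' h1 h1' (by omega), h0]
  obtain ⟨hs0, hsn, -, -⟩ := hm.fired_subset_gridSquare hsB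
  have := hE s hsB
  rw [hs, bottom, if_pos (by omega), if_neg (by omega)] at hzero
  omega

lemma IsUnitVec.exists_index {n : ℕ} {e : ℕ → ℕ} (h : IsUnitVec n e) :
    ∃ i < n, ∀ j, e j = if j = i then 1 else 0 := by
  obtain ⟨hle, hzero, i, hi, huniq⟩ := h
  refine ⟨i, ?_, fun j => ?_⟩
  · by_contra hn
    have := hzero i (not_lt.1 hn)
    omega
  · split_ifs with hj
    · exact hj ▸ hi
    · have := hle j
      have := mt (huniq j) hj
      omega

lemma add_confW {n i : ℕ} {w : ℕ → ℕ} (hi : i < n) (hw : ∀ j, w j = if j = i then 1 else 0)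
    (c : Config) : c + confW n w = withGrain c (0, (i : ℤ)) := by
  ext ⟨x, y⟩
  simp only [Pi.add_apply, confW, withGrain, hw, Prod.mk.injEq]
  split_ifs <;> omega

lemma add_confN {n i : ℕ} {w : ℕ → ℕ} (hi : i < n) (hw : ∀ j, w j = if j = i then 1 else 0)
    (c : Config) : c + confN n w = withGrain c ((i : ℤ), 0) := by
  ext ⟨x, y⟩
  simp only [Pi.add_apply, confN, withGrain, hw, Prod.mk.injEq]
  split_ifs <;> omega

/-- the Moore neighborhood of radius one cannot perform crossing. -/
theorem stmt_6 :
    ¬ CanCross ((({-1, 0, 1} : Finset ℤ) ×ˢ ({-1, 0, 1} : Finset ℤ)) \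
      ({((0 : ℤ), (0 : ℤ))} : Finset Vertex)) := by
  rintro ⟨n, c, nv, e, s, w, hnv, he, hs, hw, hstable, hsize, ⟨t, ht⟩, hWS, ⟨t', ht'⟩, hNE⟩
  obtain ⟨i, hi, hnv⟩ := hnv.exists_index
  obtain ⟨j, hj, he⟩ := he.exists_index
  obtain ⟨k, hk, hs⟩ := hs.exists_index
  obtain ⟨l, hl, hw⟩ := hw.exists_index
  simp only [IsolatedWS, IsolatedNE, add_confW hl hw, add_confN hi hnv] at ht ht' hWS hNE
  have hstable' : ∀ v, c v < 8 := fun v => (hstable v).trans_eq card_moore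
  refine not_crossing (n := n) (c := c) (w := (0, (l : ℤ))) (m := ((i : ℤ), 0))
    (e := ((n : ℤ) - 1, (j : ℤ))) (s := ((k : ℤ), (n : ℤ) - 1))
    ⟨hstable', hsize, ?_, (1, 0), by decide, ?_⟩ ⟨hstable', hsize, ?_, (0, 1), by decide, ?_⟩
    rfl rfl rfl rfl ⟨t, ht.symm ▸ ?_⟩ ⟨t', ht'.symm ▸ ?_⟩
    (fun v ⟨r, hr⟩ => hWS r v hr) (fun v ⟨r, hr⟩ => hNE r v hr)
  · simp only [gridSquare, Set.mem_ofPred_eq]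
    omega
  · simp [gridSquare]
  · simp only [gridSquare, Set.mem_ofPred_eq]
    omega
  · simp [gridSquare]
  · simp [confE, he, hj]
  · simp [confS, hs, hk]
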